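/- arXiv:2105.08924 — 3 statements merged into one kernel-verified Lean document; each statement's English description precedes it below -/
import Mathlib

section
/- Let 0 < c < 1, 0 ≤ μ < 1, ν > 0, and let g_{μ,ν} be the inner product on 𝔤_c whose matrix in the basis e₀, e₁, e₂ is [[(cμ + c − 2)/(2(c−1)c²), (μ−1)/(2(c−1)c), 0], [(μ−1)/(2(c−1)c), (μ−1)/(2(c−1)), 0], [0, 0, ν]] (this matrix is positive definite), with Ricci form Ric. Then the only endomorphism of 𝔤_c that is skew-symmetric with respect to both g_{μ,ν} and Ric is 0. (Hence the full isometry group of (G_c, g_{μ,ν}) is G_c itself.) -/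
noncomputable section

open scoped BigOperators

/-- The underlying space of the 3-dimensional Lie algebras under consideration. -/
abbrev V3 : Type := Fin 3 → ℝ

/-- The standard basis `e₀, e₁, e₂`. -/
def e3 (i : Fin 3) : V3 := Pi.single i 1

/-- The bracket of the Lie algebra `𝔤_c`:
`[e₀,e₁] = 0`, `[e₂,e₀] = e₁`, `[e₂,e₁] = −c e₀ + 2 e₁`, extended bilinearly. -/
def braC (c : ℝ) (x y : V3) : V3 :=
  ![-c * (x 2 * y 1 - y 2 * x 1),
    (x 2 * y 0 - y 2 * x 0) + 2 * (x 2 * y 1 - y 2 * x 1),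
    0]

/-- The matrix of the inner product `g_{μ,ν}` on `𝔤_c`, `0 < c < 1`, in the basis
`e₀,e₁,e₂`. -/
def Gm (c μ ν : ℝ) : Matrix (Fin 3) (Fin 3) ℝ :=
  !![(c*μ + c - 2)/(2*(c - 1)*c^2), (μ - 1)/(2*(c - 1)*c), 0;
     (μ - 1)/(2*(c - 1)*c), (μ - 1)/(2*(c - 1)), 0;
     0, 0, ν]

/-- The bilinear form associated with a matrix. -/
def gM (M : Matrix (Fin 3) (Fin 3) ℝ) (x y : V3) : ℝ :=
  ∑ i : Fin 3, ∑ j : Fin 3, M i j * x i * y j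

/-- The curvature tensor `R(X,Y)Z = ∇_X ∇_Y Z − ∇_Y ∇_X Z − ∇_{[X,Y]} Z`. -/
def Rc (br nab : V3 → V3 → V3) (X Y Z : V3) : V3 :=
  nab X (nab Y Z) - nab Y (nab X Z) - nab (br X Y) Z

/-- The Ricci form `Ric(X,Y) = tr (Z ↦ R(Z,X)Y)`. -/
def RicF (br nab : V3 → V3 → V3) (X Y : V3) : ℝ :=
  ∑ k : Fin 3, Rc br nab (e3 k) X Y k

/-- The inner product in adapted coordinates. -/
lemma gM_Gm (c μ ν : ℝ) (hc0 : 0 < c) (hc1 : c < 1) (x y : V3) :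
    gM (Gm c μ ν) x y = (1 + μ) / (2 * c^2) * (x 0 * y 0)
      + (1 - μ) / (2 * (1 - c)) * ((x 1 + x 0 / c) * (y 1 + y 0 / c)) + ν * (x 2 * y 2) := by
  have h1 : c - 1 ≠ 0 := by linarith
  have h2 : 1 - c ≠ 0 := by linarith
  have h3 : (1 - μ) / (2 * (1 - c)) = (μ - 1) / (2 * (c - 1)) := by
    rw [div_eq_div_iff (by simpa using h2) (by simpa using h1)]; ring
  rw [h3]
  simp [gM, Gm, Fin.sum_univ_three]
  field_simp
  ring

/-- The Levi-Civita product in adapted coordinates. -/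
def nabE (c p k ν : ℝ) (x y : V3) : V3 :=
  let t := -(1 - c) / c * k - c * p
  let w := -(1 - c) / c * k + c * p
  let x1 := x 1 + x 0 / c
  let y1 := y 1 + y 0 / c
  let r0 := x 2 * (-w / (2 * p) * y1) - y 2 * (x 0 + t / (2 * p) * x1)
  let r1 := x 2 * (w / (2 * k) * y 0) - y 2 * (x1 + t / (2 * k) * x 0)
  ![r0, r1 - r0 / c, (p * x 0 * y 0 + k * x1 * y1 + t / 2 * (x 0 * y1 + x1 * y 0)) / ν]

lemma nab_eq (c p k ν : ℝ) (hc0 : 0 < c) (hp : 0 < p) (hk : 0 < k) (hν : 0 < ν)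
    (g : V3 → V3 → ℝ)
    (hg : ∀ x y : V3, g x y = p * (x 0 * y 0)
      + k * ((x 1 + x 0 / c) * (y 1 + y 0 / c)) + ν * (x 2 * y 2))
    (nab : V3 → V3 → V3)
    (hK : ∀ X Y Z : V3, 2 * g (nab X Y) Z =
      g (braC c X Y) Z - g (braC c Y Z) X + g (braC c Z X) Y) :
    nab = nabE c p k ν := by
  funext X Y
  have h0 := hK X Y ![1, -1 / c, 0]
  have h1 := hK X Y ![0, 1, 0]
  have h2 := hK X Y ![0, 0, 1]
  simp only [hg, braC] at h0 h1 h2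
  simp at h0 h1 h2
  have e0 : nab X Y 0 = nabE c p k ν X Y 0 := by
    simp [nabE]
    linear_combination (norm := (field_simp; ring)) h0 / (2 * p)
  have e1 : nab X Y 1 = nabE c p k ν X Y 1 := by
    have : nab X Y 1 + nab X Y 0 / c = nabE c p k ν X Y 1 + nabE c p k ν X Y 0 / c := by
      simp [nabE]
      linear_combination (norm := (field_simp; ring)) h1 / (2 * k)
    rw [e0] at this
    linarith
  have e2 : nab X Y 2 = nabE c p k ν X Y 2 := by
    simp [nabE]
    linear_combination (norm := (field_simp; ring)) h2 / (2 * ν)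
  funext i
  fin_cases i
  · exact e0
  · exact e1
  · exact e2

lemma ric_eq (c p k ν : ℝ) (hc0 : 0 < c) (hp : 0 < p) (hk : 0 < k) (hν : 0 < ν) (x y : V3) :
    RicF (braC c) (nabE c p k ν) x y =
      let t := -(1 - c) / c * k - c * p
      let w := -(1 - c) / c * k + c * p
      let x1 := x 1 + x 0 / c
      let y1 := y 1 + y 0 / c
      (-2 * p - t * w / (2 * k)) / ν * (x 0 * y 0) + (-2 * k + t * w / (2 * p)) / ν * (x1 * y1)
        - t / ν * (x 0 * y1 + x1 * y 0) - (2 + t^2 / (2 * p * k)) * (x 2 * y 2) := by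
  simp [RicF, Rc, Fin.sum_univ_three, e3, nabE, braC]
  field_simp
  ring

lemma skew_zero (c p k ν : ℝ) (hc0 : 0 < c) (hc1 : c < 1) (hp : 0 < p) (hk : 0 < k) (hν : 0 < ν)
    (g : V3 → V3 → ℝ)
    (hg : ∀ x y : V3, g x y = p * (x 0 * y 0)
      + k * ((x 1 + x 0 / c) * (y 1 + y 0 / c)) + ν * (x 2 * y 2))
    (A : Module.End ℝ V3)
    (hA : ∀ x y : V3, g (A x) y + g x (A y) = 0)
    (hR : ∀ x y : V3, RicF (braC c) (nabE c p k ν) (A x) y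
      + RicF (braC c) (nabE c p k ν) x (A y) = 0) : A = 0 := by
  simp only [ric_eq c p k ν hc0 hp hk hν] at hR
  simp only [hg] at hA
  obtain ⟨t, ht⟩ : ∃ t, t = -(1 - c) / c * k - c * p := ⟨_, rfl⟩
  obtain ⟨w, hw⟩ : ∃ w, w = -(1 - c) / c * k + c * p := ⟨_, rfl⟩
  rw [← ht, ← hw] at hR
  have htneg : t < 0 := by
    have h1 : 0 < (1 - c) / c * k := by
      have : 0 < 1 - c := by linarith
      positivity
    have h2 : 0 < c * p := by positivity
    rw [ht, neg_div]; linarith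
  have hwt : w - t = 2 * c * p := by rw [hw, ht]; ring
  have hwt' : c * (w + t) = -(2 * (1 - c) * k) := by rw [hw, ht]; field_simp; ring
  set F0 : V3 := ![1, -1 / c, 0] with hF0
  set F1 : V3 := ![0, 1, 0] with hF1
  set F2 : V3 := ![0, 0, 1] with hF2
  have a00 := hA F0 F0
  have a01 := hA F0 F1
  have a02 := hA F0 F2
  have a11 := hA F1 F1
  have a12 := hA F1 F2
  have a22 := hA F2 F2
  have r00 := hR F0 F0
  have r02 := hR F0 F2
  have r12 := hR F1 F2
  have v00 : F0 0 = 1 := rfl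
  have v01 : F0 1 = -1 / c := rfl
  have v02 : F0 2 = 0 := rfl
  have v10 : F1 0 = 0 := rfl
  have v11 : F1 1 = 1 := rfl
  have v12 : F1 2 = 0 := rfl
  have v20 : F2 0 = 0 := rfl
  have v21 : F2 1 = 0 := rfl
  have v22 : F2 2 = 1 := rfl
  have vv : F0 1 + F0 0 / c = 0 := by rw [v00, v01]; ring
  simp only [vv] at a00 a01 a02 a11 a12 a22 r00 r02 r12
  simp only [v00, v02, v10, v11, v12, v20, v21, v22] at a00 a01 a02 a11 a12 a22 r00 r02 r12
  obtain ⟨B0, hB0⟩ : ∃ z, z = A F0 1 + A F0 0 / c := ⟨_, rfl⟩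
  obtain ⟨B1, hB1⟩ : ∃ z, z = A F1 1 + A F1 0 / c := ⟨_, rfl⟩
  obtain ⟨B2, hB2⟩ : ∃ z, z = A F2 1 + A F2 0 / c := ⟨_, rfl⟩
  simp only [← hB0, ← hB1, ← hB2] at a00 a01 a02 a11 a12 a22 r00 r02 r12
  simp only [zero_div, add_zero, mul_zero, zero_mul, mul_one, one_mul, zero_add, sub_zero]
    at a00 a01 a02 a11 a12 a22 r00 r02 r12
  have p00 : A F0 0 = 0 := by
    have : p * A F0 0 = 0 := by linarith
    simpa [hp.ne'] using this
  have p11 : B1 = 0 := by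
    have : k * B1 = 0 := by linarith
    simpa [hk.ne'] using this
  have p22 : A F2 2 = 0 := by
    have : ν * A F2 2 = 0 := by linarith
    simpa [hν.ne'] using this
  have p01 : B0 = 0 := by
    rw [p00] at r00
    have : t / ν * B0 = 0 := by linarith
    simpa [hν.ne', htneg.ne] using this
  have p10 : A F1 0 = 0 := by
    rw [p01] at a01
    have : p * A F1 0 = 0 := by linarith
    simpa [hp.ne'] using this
  obtain ⟨z, hz⟩ : ∃ z, z = A F0 2 := ⟨_, rfl⟩
  obtain ⟨u, hu⟩ : ∃ u, u = A F1 2 := ⟨_, rfl⟩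
  rw [← hz] at a02 r02
  rw [← hu] at a12 r12
  have hz2 : A F2 0 = -(ν * z) / p := by field_simp; linarith
  have hu2 : B2 = -(ν * u) / k := by field_simp; linarith
  rw [hz2, hu2] at r02 r12
  have s1 : c * z + u = 0 := by
    have : t * (p * (2 * (c * z + u))) = 0 := by
      linear_combination (norm := (field_simp; ring)) 2 * p * k * r02 - t * z * hwt
    simpa [hp.ne', htneg.ne] using this
  have s2 : c * z + (1 - c) * u = 0 := by
    have : t * (k * (2 * (c * z + (1 - c) * u))) = 0 := by
      linear_combination (norm := (field_simp; ring)) 2 * p * k * c * r12 + t * u * hwt'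
    simpa [hk.ne', htneg.ne] using this
  have u0 : u = 0 := by
    have : c * u = 0 := by linarith
    simpa [hc0.ne'] using this
  have z0 : z = 0 := by
    have : c * z = 0 := by linarith
    simpa [hc0.ne'] using this
  subst u0 z0
  have q20 : A F2 0 = 0 := by rw [hz2]; simp
  have A0 : A F0 = 0 := by
    funext i; fin_cases i
    · exact p00
    · simp; simpa [p00, p01] using hB0.symm
    · exact hz.symm
  have A1 : A F1 = 0 := by
    funext i; fin_cases i
    · exact p10
    · simp; simpa [p10, p11] using hB1.symm
    · exact hu.symm
  have A2 : A F2 = 0 := by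
    funext i; fin_cases i
    · exact q20
    · simp; simpa [q20, hu2] using hB2.symm
    · exact p22
  refine LinearMap.ext fun x => ?_
  have hx : x = x 0 • F0 + (x 1 + x 0 / c) • F1 + x 2 • F2 := by
    funext i; fin_cases i
    · simp [hF0, hF1, hF2]
    · simp [hF0, hF1, hF2]; ring
    · simp [hF0, hF1, hF2]
  rw [hx]
  simp [A0, A1, A2]

/-- for `0 < c < 1`, the given matrix of `g_{μ,ν}` is positive definite
and the only endomorphism of `𝔤_c` that is skew-symmetric with respect to both
`g_{μ,ν}` and its Ricci form is `0`. -/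
theorem stmt11 (c μ ν : ℝ) (hc0 : 0 < c) (hc1 : c < 1) (hμ0 : 0 ≤ μ) (hμ1 : μ < 1)
    (hν : 0 < ν) (nab : V3 → V3 → V3)
    (hK : ∀ X Y Z : V3, 2 * gM (Gm c μ ν) (nab X Y) Z =
      gM (Gm c μ ν) (braC c X Y) Z - gM (Gm c μ ν) (braC c Y Z) X
        + gM (Gm c μ ν) (braC c Z X) Y) :
    (Gm c μ ν).PosDef ∧
    (∀ A : Module.End ℝ V3,
      (∀ x y : V3, gM (Gm c μ ν) (A x) y + gM (Gm c μ ν) x (A y) = 0) →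
      (∀ x y : V3, RicF (braC c) nab (A x) y + RicF (braC c) nab x (A y) = 0) →
      A = 0) := by
  have hp : 0 < (1 + μ) / (2 * c^2) := by positivity
  have hk : 0 < (1 - μ) / (2 * (1 - c)) := by
    have h1 : 0 < 1 - μ := by linarith
    have h2 : 0 < 1 - c := by linarith
    positivity
  have hg := gM_Gm c μ ν hc0 hc1
  refine ⟨?_, ?_⟩
  · refine Matrix.PosDef.of_dotProduct_mulVec_pos ?_ ?_
    · ext i j
      fin_cases i <;> fin_cases j <;> simp [Gm]
    · intro x hx
      have e : star x ⬝ᵥ (Gm c μ ν).mulVec x = gM (Gm c μ ν) x x := by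
        simp [gM, dotProduct, Matrix.mulVec, Fin.sum_univ_three]
        ring
      rw [e, hg]
      obtain ⟨p, hpe⟩ : ∃ p, p = (1 + μ) / (2 * c^2) := ⟨_, rfl⟩
      obtain ⟨k, hke⟩ : ∃ k, k = (1 - μ) / (2 * (1 - c)) := ⟨_, rfl⟩
      rw [← hpe, ← hke]
      rw [← hpe] at hp
      rw [← hke] at hk
      by_contra hneg
      have n0 : 0 ≤ p * (x 0 * x 0) := mul_nonneg hp.le (mul_self_nonneg _)
      have n1 : 0 ≤ k * ((x 1 + x 0 / c) * (x 1 + x 0 / c)) :=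
        mul_nonneg hk.le (mul_self_nonneg _)
      have n2 : 0 ≤ ν * (x 2 * x 2) := mul_nonneg hν.le (mul_self_nonneg _)
      have m0 : p * (x 0 * x 0) = 0 := by linarith
      have m1 : k * ((x 1 + x 0 / c) * (x 1 + x 0 / c)) = 0 := by linarith
      have m2 : ν * (x 2 * x 2) = 0 := by linarith
      have x0 : x 0 = 0 := by simpa [hp.ne'] using m0
      have x1 : x 1 = 0 := by simpa [hk.ne', x0] using m1
      have x2 : x 2 = 0 := by simpa [hν.ne'] using m2
      apply hx
      funext i; fin_cases i
      · exact x0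
      · exact x1
      · exact x2
  · intro A hA hR
    rw [nab_eq c _ _ ν hc0 hp hk hν _ hg nab hK] at hR
    exact skew_zero c _ _ ν hc0 hc1 hp hk hν _ hg A hA hR
end
end

section
/- Let c > 1, 1 < μ < c, ν > 0, and let g_{μ,ν} be the inner product on 𝔤_c whose matrix in the basis e₀, e₁, e₂ is [[1, 1, 0], [1, μ, 0], [0, 0, ν]], with Levi-Civita product ∇. Then the symmetry subspace 𝔰 = {v ∈ 𝔤_c : ∇_u v = [u,v] for all u ∈ 𝔤_c} equals the line ℝ·(((c − 3√c + 2)/(√c − 1))·e₀ + e₁) if μ = (√c − 1)² + 1, and equals {0} if μ ≠ (√c − 1)² + 1. (Consequently the index of symmetry of (G_c, g_{μ,ν}) is 1 when μ = (√c − 1)² + 1 and 0 otherwise for 1 < μ < c.) -/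
noncomputable section

open scoped BigOperators

/-- The inner product `g_{μ,ν}` on `𝔤_c`, `c > 1`, with matrix
`[[1,1,0],[1,μ,0],[0,0,ν]]` in the basis `e₀,e₁,e₂`. -/
def gT (μ ν : ℝ) (x y : V3) : ℝ :=
  x 0 * y 0 + (x 0 * y 1 + x 1 * y 0) + μ * (x 1 * y 1) + ν * (x 2 * y 2)

/-- Non-degeneracy of `g_{μ,ν}`. -/
theorem gT_ext (μ ν : ℝ) (hμ1 : 1 < μ) (hν : 0 < ν) (x y : V3)
    (h : ∀ Z, gT μ ν x Z = gT μ ν y Z) : x = y := by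
  have h0 := h (e3 0)
  have h1 := h (e3 1)
  have h2 := h (e3 2)
  simp [gT, e3, Pi.single_apply] at h0 h1 h2
  have k1 : (μ - 1) * (x 1 - y 1) = 0 := by linarith
  have k1' : x 1 = y 1 := by
    rcases mul_eq_zero.1 k1 with h | h <;> linarith
  have k2 : x 2 = y 2 := by
    rcases h2 with h | h <;> linarith
  have k0 : x 0 = y 0 := by linarith
  ext i
  fin_cases i
  · exact k0
  · exact k1'
  · exact k2

/-- The symmetry condition as linear equations on the coordinates. -/
theorem sym_iff (c μ ν : ℝ) (hc : 1 < c) (hμ1 : 1 < μ) (hν : 0 < ν)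
    (nab : V3 → V3 → V3)
    (hK : ∀ X Y Z : V3, 2 * gT μ ν (nab X Y) Z =
      gT μ ν (braC c X Y) Z - gT μ ν (braC c Y Z) X + gT μ ν (braC c Z X) Y) (v : V3) :
    (∀ u : V3, nab u v = braC c u v) ↔
      v 2 = 0 ∧ 2 * v 0 + (2 - c + μ) * v 1 = 0 ∧
        (μ + 2 - c) * v 0 + (4 * μ - 2 * c) * v 1 = 0 := by
  constructor
  · intro h
    have h01 := hK (e3 0) v (e3 1)
    have h20 := hK (e3 2) v (e3 0)
    have h21 := hK (e3 2) v (e3 1)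
    rw [h] at h01 h20 h21
    simp [gT, braC, e3, Pi.single_apply] at h01 h20 h21
    have k : (μ + c - 2) * v 2 = 0 := by linarith
    have k2 : v 2 = 0 := by
      rcases mul_eq_zero.1 k with h | h <;> linarith
    refine ⟨k2, ?_, ?_⟩ <;> linarith
  · rintro ⟨h2, h0, h1⟩ u
    apply gT_ext μ ν hμ1 hν
    intro Z
    have hk := hK u v Z
    simp only [gT, braC, Matrix.cons_val, h2] at hk ⊢
    linear_combination hk / 2 - (u 2 * Z 0 - Z 2 * u 0) / 2 * h0
      - (u 2 * Z 1 - Z 2 * u 1) / 2 * h1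

/-- for `c > 1` and `1 < μ < c`, the symmetry subspace
`𝔰 = {v : ∇_u v = [u,v] for all u}` of `(𝔤_c, g_{μ,ν})` is the line
`ℝ (((c − 3√c + 2)/(√c − 1)) e₀ + e₁)` when `μ = (√c − 1)² + 1`, and `{0}`
otherwise. -/
theorem stmt18 (c μ ν : ℝ) (hc : 1 < c) (hμ1 : 1 < μ) (hμc : μ < c) (hν : 0 < ν)
    (nab : V3 → V3 → V3)
    (hK : ∀ X Y Z : V3, 2 * gT μ ν (nab X Y) Z =
      gT μ ν (braC c X Y) Z - gT μ ν (braC c Y Z) X + gT μ ν (braC c Z X) Y) :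
    (μ = (Real.sqrt c - 1)^2 + 1 → ∀ v : V3,
      (∀ u : V3, nab u v = braC c u v) ↔
        ∃ t : ℝ, v = t • (((c - 3*Real.sqrt c + 2)/(Real.sqrt c - 1)) • e3 0 + e3 1)) ∧
    (μ ≠ (Real.sqrt c - 1)^2 + 1 → ∀ v : V3,
      (∀ u : V3, nab u v = braC c u v) ↔ v = 0) := by
  have hs2 : Real.sqrt c ^ 2 = c := Real.sq_sqrt (by linarith)
  have hs1 : 1 < Real.sqrt c := by
    rw [Real.lt_sqrt] <;> linarith
  generalize Real.sqrt c = s at hs2 hs1 ⊢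
  subst hs2
  have hq : (s ^ 2 - 3 * s + 2) / (s - 1) = s - 2 := by
    rw [div_eq_iff (by linarith)]; ring
  rw [hq]
  constructor
  · rintro hμ v
    rw [sym_iff _ μ ν hc hμ1 hν nab hK v]
    constructor
    · rintro ⟨h2, h0, h1⟩
      refine ⟨v 1, ?_⟩
      have k0 : v 0 = v 1 * (s - 2) := by
        rw [hμ] at h0
        linarith
      ext i
      fin_cases i <;> simp [e3, h2, k0]
    · rintro ⟨t, rfl⟩
      simp [e3, hμ]
      constructor <;> ring
  · rintro hμ v
    rw [sym_iff _ μ ν hc hμ1 hν nab hK v]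
    constructor
    · rintro ⟨h2, h0, h1⟩
      have k : ((μ - ((s - 1) ^ 2 + 1)) * ((s + 1) ^ 2 + 1 - μ)) * v 1 = 0 := by
        linear_combination 2 * h1 - (μ + 2 - s ^ 2) * h0
      have n1 : μ - ((s - 1) ^ 2 + 1) ≠ 0 := sub_ne_zero.2 hμ
      have n2 : (s + 1) ^ 2 + 1 - μ ≠ 0 := by nlinarith
      have k1 : v 1 = 0 := by
        rcases mul_eq_zero.1 k with h | h
        · exact absurd h (mul_ne_zero n1 n2)
        · exact h
      have k0 : v 0 = 0 := by
        rw [k1] at h0; linarith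
      ext i
      fin_cases i <;> simp [k0, k1, h2]
    · rintro rfl
      simp
end
end

section
/- Let 0 < c < 1, 0 ≤ μ < 1, ν > 0, and let g_{μ,ν} be the inner product on 𝔤_c whose matrix in the basis e₀, e₁, e₂ is [[(cμ + c − 2)/(2(c−1)c²), (μ−1)/(2(c−1)c), 0], [(μ−1)/(2(c−1)c), (μ−1)/(2(c−1)), 0], [0, 0, ν]]. Then the scalar curvature of (𝔤_c, g_{μ,ν}), i.e. the trace with respect to g_{μ,ν} of the Ricci form, equals −2(4 − c − 3μ²)/((1 − μ²)ν). In particular, for μ = √c the scalar curvature equals −8/ν, independently of c. -/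
noncomputable section

open scoped BigOperators

/-- Bilinear product with generic coefficients, of the shape of the Levi-Civita product. -/
def nabG (s t u w k1 k2 k3 k4 α β γ : ℝ) (X Y : V3) : V3 :=
  ![-(s * X 0 + t * X 1) * Y 2 + X 2 * (k1 * Y 0 + k2 * Y 1),
    -(u * X 0 + w * X 1) * Y 2 + X 2 * (k3 * Y 0 + k4 * Y 1),
    α * X 0 * Y 0 + β * (X 0 * Y 1 + X 1 * Y 0) + γ * X 1 * Y 1]

/-- The Ricci form of a generic product, as an explicit quadratic form. -/
lemma ric_quad (c s t u w k1 k2 k3 k4 α β γ : ℝ) (X : V3) :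
    RicF (braC c) (nabG s t u w k1 k2 k3 k4 α β γ) X X =
      ∑ i, ∑ j, RicF (braC c) (nabG s t u w k1 k2 k3 k4 α β γ) (e3 i) (e3 j) * (X i * X j) := by
  simp [RicF, Rc, braC, nabG, e3, Fin.sum_univ_three]
  ring

/-- Orthonormal bases: the sum of `b i ⊗ b i` is the inverse matrix. -/
lemma gram_inv (M N : Matrix (Fin 3) (Fin 3) ℝ) (hMN : N * M = 1) (b : Fin 3 → V3)
    (hb : ∀ i j : Fin 3, gM M (b i) (b j) = if i = j then 1 else 0) (j k : Fin 3) :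
    ∑ i, b i j * b i k = N j k := by
  let B : Matrix (Fin 3) (Fin 3) ℝ := Matrix.of b
  have h1 : B * M * B.transpose = 1 := by
    ext i j
    rw [Matrix.one_apply, ← hb i j]
    simp [B, gM, Matrix.mul_apply, Fin.sum_univ_three]
    ring
  have h2 : M * (B.transpose * B) = 1 := by
    rw [← Matrix.mul_assoc]
    rw [Matrix.mul_assoc] at h1
    exact mul_eq_one_comm.mp h1
  have h3 : B.transpose * B = N := by
    calc B.transpose * B = N * M * (B.transpose * B) := by rw [hMN, one_mul]
      _ = N := by rw [Matrix.mul_assoc, h2, mul_one]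
  rw [← h3]
  simp [B, Matrix.mul_apply]

/-- The Levi-Civita product for a block metric. -/
lemma nab_eq_s19 (c p q r v D : ℝ) (hD : D = p * r - q ^ 2) (hD0 : D ≠ 0) (hv : v ≠ 0)
    (nab : V3 → V3 → V3)
    (hK : ∀ X Y Z : V3, 2 * gM !![p, q, 0; q, r, 0; 0, 0, v] (nab X Y) Z =
      gM !![p, q, 0; q, r, 0; 0, 0, v] (braC c X Y) Z
        - gM !![p, q, 0; q, r, 0; 0, 0, v] (braC c Y Z) X
        + gM !![p, q, 0; q, r, 0; 0, 0, v] (braC c Z X) Y) :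
    nab = nabG ((r * q - q * ((r - c * p + 2 * q) / 2)) / D)
      ((r * ((r - c * p + 2 * q) / 2) - q * (2 * r - c * q)) / D)
      ((-q * q + p * ((r - c * p + 2 * q) / 2)) / D)
      ((-q * ((r - c * p + 2 * q) / 2) + p * (2 * r - c * q)) / D)
      (((-c * p + 2 * q - r) / 2) * q / D) (((-c * p + 2 * q - r) / 2) * r / D)
      (-((-c * p + 2 * q - r) / 2) * p / D) (-((-c * p + 2 * q - r) / 2) * q / D)
      (q / v) ((r - c * p + 2 * q) / 2 / v) ((2 * r - c * q) / v) := by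
  funext X Y
  have h0 := hK X Y (e3 0)
  have h1 := hK X Y (e3 1)
  have h2 := hK X Y (e3 2)
  simp [gM, braC, e3, Fin.sum_univ_three] at h0 h1 h2
  ext i
  fin_cases i
  · simp [nabG]
    field_simp
    rw [hD]
    linear_combination r * h0 - q * h1
  · simp [nabG]
    field_simp
    rw [hD]
    linear_combination p * h1 - q * h0
  · simp [nabG]
    field_simp
    linear_combination h2

/-- for `0 < c < 1`, the scalar curvature of `(𝔤_c, g_{μ,ν})`, i.e.
`∑ᵢ Ric(uᵢ,uᵢ)` for any `g_{μ,ν}`-orthonormal basis `(uᵢ)`, equals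
`−2(4 − c − 3μ²)/((1 − μ²)ν)`; in particular for `μ = √c` it equals `−8/ν`,
independently of `c`. -/
theorem stmt19 (c μ ν : ℝ) (hc0 : 0 < c) (hc1 : c < 1) (hμ0 : 0 ≤ μ) (hμ1 : μ < 1)
    (hν : 0 < ν) (nab : V3 → V3 → V3)
    (hK : ∀ X Y Z : V3, 2 * gM (Gm c μ ν) (nab X Y) Z =
      gM (Gm c μ ν) (braC c X Y) Z - gM (Gm c μ ν) (braC c Y Z) X
        + gM (Gm c μ ν) (braC c Z X) Y) :
    (∀ b : Fin 3 → V3,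
      (∀ i j : Fin 3, gM (Gm c μ ν) (b i) (b j) = if i = j then 1 else 0) →
      ∑ i : Fin 3, RicF (braC c) nab (b i) (b i)
        = -(2*(4 - c - 3*μ^2))/((1 - μ^2)*ν)) ∧
    (μ = Real.sqrt c → ∀ b : Fin 3 → V3,
      (∀ i j : Fin 3, gM (Gm c μ ν) (b i) (b j) = if i = j then 1 else 0) →
      ∑ i : Fin 3, RicF (braC c) nab (b i) (b i) = -8/ν) := by
  have hc : c ≠ 0 := hc0.ne'
  have hc' : c - 1 ≠ 0 := by linarith
  have hv : ν ≠ 0 := hν.ne'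
  have hm1 : 1 - μ ≠ 0 := by linarith
  have hm2 : 1 + μ ≠ 0 := by linarith
  have hm3 : 1 - μ ^ 2 ≠ 0 := by
    have : 1 - μ ^ 2 = (1 - μ) * (1 + μ) := by ring
    rw [this]; exact mul_ne_zero hm1 hm2
  have hD : (1 - μ ^ 2) / (-4 * (c - 1) * c ^ 2) = (c*μ + c - 2)/(2*(c - 1)*c^2) *
      ((μ - 1)/(2*(c - 1))) - ((μ - 1)/(2*(c - 1)*c)) ^ 2 := by
    field_simp
    ring
  have hD0 : (1 - μ ^ 2) / (-4 * (c - 1) * c ^ 2) ≠ 0 :=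
    div_ne_zero hm3 (mul_ne_zero (mul_ne_zero (by norm_num) hc') (pow_ne_zero 2 hc))
  have hmain : ∀ b : Fin 3 → V3,
      (∀ i j : Fin 3, gM (Gm c μ ν) (b i) (b j) = if i = j then 1 else 0) →
      ∑ i : Fin 3, RicF (braC c) nab (b i) (b i)
        = -(2*(4 - c - 3*μ^2))/((1 - μ^2)*ν) := by
    intro b hb
    have hS := gram_inv (Gm c μ ν)
      !![2 * c ^ 2 / (1 + μ), -2 * c / (1 + μ), 0;
         -2 * c / (1 + μ), 2 * (2 - c - c * μ) / (1 - μ ^ 2), 0;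
         0, 0, 1 / ν] (by
        have hm4 : μ - 1 ≠ 0 := by linarith
        ext i j
        fin_cases i <;> fin_cases j <;>
          simp [Gm, Matrix.mul_apply, Fin.sum_univ_three] <;> field_simp <;> ring) b hb
    have hn := nab_eq_s19 c _ _ _ ν _ hD hD0 hv nab hK
    rw [hn]
    have hsum : ∀ R : Fin 3 → Fin 3 → ℝ, ∑ i, ∑ j, ∑ k, R j k * (b i j * b i k) =
        ∑ j, ∑ k, R j k * ∑ i, b i j * b i k := by
      intro R
      simp only [Fin.sum_univ_three]
      ring
    rw [Finset.sum_congr rfl (fun i _ => ric_quad c _ _ _ _ _ _ _ _ _ _ _ (b i)),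
      hsum (fun j k => RicF (braC c) _ (e3 j) (e3 k))]
    simp only [hS]
    simp [RicF, Rc, braC, nabG, e3, Fin.sum_univ_three]
    field_simp
    ring
  refine ⟨hmain, fun hμ b hb => ?_⟩
  rw [hmain b hb]
  have hsq : μ ^ 2 = c := by rw [hμ]; exact Real.sq_sqrt hc0.le
  rw [hsq]
  have : 1 - c ≠ 0 := by linarith
  field_simp
  ring
end
end
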